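/- Define, for a smooth zero-mean vector field u on T³, the matrix field Ru := ∇⊗(Δ⁻¹u) + (∇⊗(Δ⁻¹u))ᵀ − ½((∇⊗∇)Δ⁻¹ + Id) div(Δ⁻¹u). Then Ru takes values in the symmetric traceless 3×3 matrices, div(Ru) = u (so R is a right inverse of the divergence operator), and for every p ∈ (1,∞) there is a constant C(p) with ‖Ru‖_{L^p(T³)} ≤ C(p)‖u‖_{L^p(T³)} for all smooth zero-mean vector fields u. -/

import Mathlib

open MeasureTheory Real
open scoped ENNReal NNReal

noncomputable section

abbrev R3 := Fin 3 → ℝ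
abbrev Z3 := Fin 3 → ℤ

def cube : Set R3 := Set.univ.pi fun _ => Set.Icc 0 (2 * π)

def μT3 : Measure R3 := volume.restrict cube

def Periodic3 {α : Type*} (u : R3 → α) : Prop :=
  ∀ (x : R3) (k : Z3), u (fun i => x i + 2 * π * (k i)) = u x

def dotZ (n : Z3) (x : R3) : ℝ := ∑ i, (n i : ℝ) * x i

def eZ (n : Z3) (x : R3) : ℂ := Complex.exp (Complex.I * (dotZ n x : ℂ))

def fCoeff (u : R3 → ℂ) (n : Z3) : ℂ :=
  (1 / (2 * π) ^ 3 : ℝ) • ∫ y in cube, Complex.exp (-(Complex.I * (dotZ n y : ℂ))) * u y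

def normZsq (n : Z3) : ℝ := ∑ i, (n i : ℝ) ^ 2

def pd {E : Type*} [NormedAddCommGroup E] [NormedSpace ℝ E] (i : Fin 3) (h : R3 → E) :
    R3 → E :=
  fun x => fderiv ℝ h x (Pi.single i 1)

abbrev M3C := Fin 3 → Fin 3 → ℂ

/-- Inverse Laplacian `Δ⁻¹` on zero-mean functions on `T³`: the Fourier multiplier with
symbol `-|n|⁻²` on nonzero frequencies. -/
def invLapC (h : R3 → ℂ) (x : R3) : ℂ :=
  ∑' n : Z3, (if n = 0 then 0 else -(1 : ℂ) / (normZsq n : ℂ)) * fCoeff h n * eZ n x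

def invLapV (u : R3 → R3) (j : Fin 3) : R3 → ℂ :=
  invLapC fun y => (u y j : ℂ)

/-- `div (Δ⁻¹ u)`. -/
def divInvLap (u : R3 → R3) (x : R3) : ℂ :=
  ∑ j, pd j (invLapV u j) x

/-- The inverse divergence operator
`Ru = ∇⊗(Δ⁻¹u) + (∇⊗(Δ⁻¹u))ᵀ - ½((∇⊗∇)Δ⁻¹ + Id) div(Δ⁻¹u)`. -/
def Rinv (u : R3 → R3) (x : R3) : M3C := fun i j =>
  pd i (invLapV u j) x + pd j (invLapV u i) x
    - (1 / 2 : ℂ) * (pd i (pd j (invLapC (divInvLap u))) x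
        + if i = j then divInvLap u x else 0)

section

abbrev T3 := UnitAddTorus (Fin 3)

attribute [local instance] instMeasureSpaceUnitAddCircle

instance haarInst3 : Measure.IsAddHaarMeasure (volume : Measure UnitAddCircle) :=
  inferInstanceAs (Measure.IsAddHaarMeasure AddCircle.haarAddCircle)

instance probInst3 : IsProbabilityMeasure (volume : Measure UnitAddCircle) :=
  inferInstanceAs (IsProbabilityMeasure AddCircle.haarAddCircle)

lemma haar_mp (t : ℝ) : MeasurePreserving (fun x : ℝ => (x : UnitAddCircle))
    (volume.restrict (Set.Ioc t (t+1))) (volume : Measure UnitAddCircle) := by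
  have h := AddCircle.measurePreserving_mk 1 t
  rw [AddCircle.volume_eq_smul_haarAddCircle] at h
  simp only [ENNReal.ofReal_one, one_smul] at h
  exact h

lemma circ_zero : (volume : Measure UnitAddCircle) {0} = 0 := by
  have h := (haar_mp 0).measure_preimage (s := {0}) (measurableSet_singleton _).nullMeasurableSet
  rw [← h]
  apply measure_mono_null (t := Set.range (fun n : ℤ => (n : ℝ))) _
    ((Set.countable_range _).measure_zero _)
  intro x hx
  simp only [Set.mem_preimage, Set.mem_singleton_iff] at hx
  obtain ⟨n, hn⟩ := (AddCircle.coe_eq_zero_iff (p := (1:ℝ))).1 hx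
  exact ⟨n, by simpa using hn⟩

lemma young_ineq (K g : C(T3, ℂ)) (p : ℝ≥0∞) (hp1 : 1 < p) (hp : p < ⊤) :
    eLpNorm (fun x => ∫ y, K y * g (x - y)) p volume ≤
      (∫⁻ y, ‖K y‖ₑ) * eLpNorm (fun x => g x) p volume := by
  have hp0 : p ≠ 0 := (zero_lt_one.trans hp1).ne'
  rw [eLpNorm_eq_lintegral_rpow_enorm_toReal hp0 hp.ne,
    eLpNorm_eq_lintegral_rpow_enorm_toReal hp0 hp.ne]
  set r := p.toReal with hr
  have hr1 : 1 < r := by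
    rw [hr, ← ENNReal.toReal_one]; exact (ENNReal.toReal_lt_toReal (by simp) hp.ne).2 hp1
  have hr0 : 0 < r := by linarith
  set A := ∫⁻ y, ‖K y‖ₑ with hA
  obtain ⟨q, hq⟩ : ∃ q, r.HolderConjugate q := ⟨_, Real.HolderConjugate.conjExponent hr1⟩
  have hq0 : 0 < q := hq.symm.pos
  have hK : Measurable fun y => ‖K y‖ₑ := K.continuous.measurable.enorm
  have hg : Measurable fun y => ‖g y‖ₑ := g.continuous.measurable.enorm
  have pt : ∀ x, ‖∫ y, K y * g (x - y)‖ₑ ^ r ≤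
      A ^ (r / q) * ∫⁻ y, ‖K y‖ₑ * ‖g (x - y)‖ₑ ^ r := by
    intro x
    have hgx : Measurable fun y => ‖g (x - y)‖ₑ := hg.comp (measurable_const.sub measurable_id)
    have h1 : ‖∫ y, K y * g (x - y)‖ₑ ≤
        A ^ (1 / q) * (∫⁻ y, ‖K y‖ₑ * ‖g (x - y)‖ₑ ^ r) ^ (1 / r) := by
      refine (enorm_integral_le_lintegral_enorm _).trans ?_
      have := ENNReal.lintegral_mul_le_Lp_mul_Lq (volume : Measure T3) hq.symm
        (f := fun y => ‖K y‖ₑ ^ (1/q)) (g := fun y => ‖K y‖ₑ ^ (1/r) * ‖g (x - y)‖ₑ)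
        (hK.pow_const _).aemeasurable ((hK.pow_const _).mul hgx).aemeasurable
      refine le_trans (le_of_eq ?_) (this.trans (le_of_eq ?_))
      · refine lintegral_congr fun y => ?_
        simp only [Pi.mul_apply, enorm_mul]
        rw [← mul_assoc, ← ENNReal.rpow_add_of_nonneg _ _ (by positivity) (by positivity)]
        rw [show 1 / q + 1 / r = 1 by simpa [add_comm] using hq.inv_add_inv_eq_one]
        simp
      · congr 2
        · refine lintegral_congr fun y => ?_
          rw [← ENNReal.rpow_mul, one_div_mul_cancel hq0.ne', ENNReal.rpow_one]
        · refine lintegral_congr fun y => ?_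
          rw [ENNReal.mul_rpow_of_nonneg _ _ hr0.le, ← ENNReal.rpow_mul,
            one_div_mul_cancel hr0.ne', ENNReal.rpow_one]
    refine (ENNReal.rpow_le_rpow h1 hr0.le).trans (le_of_eq ?_)
    rw [ENNReal.mul_rpow_of_nonneg _ _ hr0.le, ← ENNReal.rpow_mul, ← ENNReal.rpow_mul,
      one_div_mul_cancel hr0.ne', ENNReal.rpow_one]
    congr 2; ring
  have key : ∫⁻ x, ‖∫ y, K y * g (x - y)‖ₑ ^ r ≤ A ^ r * ∫⁻ x, ‖g x‖ₑ ^ r := by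
    have hm : Measurable (Function.uncurry fun (x y : T3) => ‖K y‖ₑ * ‖g (x - y)‖ₑ ^ r) := by
      apply Measurable.mul
      · exact hK.comp measurable_snd
      · exact (hg.comp (measurable_fst.sub measurable_snd)).pow_const _
    calc ∫⁻ x, ‖∫ y, K y * g (x - y)‖ₑ ^ r
        ≤ ∫⁻ x, A ^ (r / q) * ∫⁻ y, ‖K y‖ₑ * ‖g (x - y)‖ₑ ^ r := lintegral_mono pt
      _ = A ^ (r / q) * ∫⁻ x, ∫⁻ y, ‖K y‖ₑ * ‖g (x - y)‖ₑ ^ r :=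
          lintegral_const_mul _ (hm.lintegral_prod_right)
      _ = A ^ (r / q) * ∫⁻ y, ∫⁻ x, ‖K y‖ₑ * ‖g (x - y)‖ₑ ^ r := by
          rw [lintegral_lintegral_swap hm.aemeasurable]
      _ = A ^ (r / q) * ∫⁻ y, ‖K y‖ₑ * ∫⁻ x, ‖g x‖ₑ ^ r := by
          congr 1
          refine lintegral_congr fun y => ?_
          have hgy : Measurable fun x => ‖g (x - y)‖ₑ ^ r :=
            (hg.comp (measurable_id.sub_const y)).pow_const _
          rw [lintegral_const_mul _ hgy]
          congr 1
          exact lintegral_sub_right_eq_self (fun x => ‖g x‖ₑ ^ r) y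
      _ = A ^ (r / q) * (A * ∫⁻ x, ‖g x‖ₑ ^ r) := by
          rw [lintegral_mul_const _ hK]
      _ = A ^ r * ∫⁻ x, ‖g x‖ₑ ^ r := by
          rw [← mul_assoc]
          congr 1
          nth_rewrite 2 [← ENNReal.rpow_one A]
          rw [← ENNReal.rpow_add_of_nonneg _ _ (by positivity) (by positivity)]
          congr 1
          have := hq.div_conj_eq_sub_one
          linarith
  refine (ENNReal.rpow_le_rpow key (by positivity)).trans (le_of_eq ?_)
  rw [ENNReal.mul_rpow_of_nonneg _ _ (by positivity), ← ENNReal.rpow_mul,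
    mul_one_div_cancel hr0.ne', ENNReal.rpow_one]

lemma circ_int : Integrable (fun t : UnitAddCircle => ‖fourier 1 t - 1‖ ^ (-(2/3) : ℝ)) := by
  have hmeas : Measurable (fun t : UnitAddCircle => ‖fourier 1 t - 1‖ ^ (-(2/3) : ℝ)) :=
    (((fourier 1).continuous.sub continuous_const).norm.measurable).pow_const _
  rw [← (haar_mp (-(1/2))).integrable_comp hmeas.aestronglyMeasurable]
  have h0 : IntegrableOn (fun t : ℝ => |t| ^ (-(2/3) : ℝ)) (Set.Ioc (-(1/2)) (-(1/2)+1)) := by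
    have a3 : IntervalIntegrable (fun t : ℝ => |t| ^ (-(2/3) : ℝ)) volume (-(1/2)) (1/2) := by
      refine intervalIntegrable_of_even (fun x => by simp) (fun x hx => ?_)
      refine (intervalIntegral.intervalIntegrable_rpow' (r := -(2/3)) (by norm_num)
        (a := 0) (b := x)).congr ?_
      intro t ht
      rw [Set.uIoc_of_le hx.le] at ht
      simp only [abs_of_pos ht.1]
    rw [intervalIntegrable_iff_integrableOn_Ioc_of_le (by norm_num)] at a3
    rw [show (-(1/2) + 1 : ℝ) = 1/2 by norm_num]
    exact a3
  refine Integrable.mono' h0 (hmeas.comp (haar_mp (-(1/2))).measurable).aestronglyMeasurable ?_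
  refine (ae_restrict_iff' measurableSet_Ioc).2 (ae_of_all _ fun t ht => ?_)
  simp only [Function.comp]
  rw [Real.norm_of_nonneg (by positivity)]
  have e : ‖fourier 1 (t : UnitAddCircle) - 1‖ = 2 * |Real.sin (π * t)| := by
    rw [fourier_coe_apply]
    have := Complex.norm_exp_I_mul_ofReal_sub_one (2 * π * t)
    rw [show (2 * π * t) / 2 = π * t by ring] at this
    rw [norm_mul, Real.norm_eq_abs, Real.norm_eq_abs, abs_two] at this
    rw [← this]; congr 3; push_cast; simp; ring
  rw [e]
  by_cases ht0 : t = 0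
  · subst ht0; simp
  apply Real.rpow_le_rpow_of_nonpos (abs_pos.2 ht0) _ (by norm_num)
  have hpi := Real.pi_pos
  have hh : |π * t| ≤ π / 2 := by
    rw [abs_mul, abs_of_pos hpi]
    have : |t| ≤ 1/2 := abs_le.2 ⟨ht.1.le, by linarith [ht.2]⟩
    nlinarith
  have := Real.mul_abs_le_abs_sin hh
  rw [abs_mul, abs_of_pos hpi, ← mul_assoc, div_mul_cancel₀ _ hpi.ne'] at this
  linarith [abs_nonneg t]

def Wt (x : T3) : ℝ := ∑ j, ‖fourier 1 (x j) - 1‖ ^ 2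

lemma Wt_cont : Continuous Wt := by
  unfold Wt; fun_prop

lemma Wt_lint : ∫⁻ x, (ENNReal.ofReal (Wt x))⁻¹ < ⊤ := by
  have h := Integrable.fintype_prod (ι := Fin 3) (μ := fun _ => (volume : Measure UnitAddCircle))
    (f := fun _ t => ‖fourier 1 t - 1‖ ^ (-(2/3) : ℝ)) (fun _ => circ_int)
  have hae : ∀ᵐ x : T3, ∀ j, x j ≠ 0 := by
    rw [ae_all_iff]; intro j
    have := (measurePreserving_eval (fun _ : Fin 3 => (volume : Measure UnitAddCircle)) j).measure_preimage
      (s := {0}) (measurableSet_singleton _).nullMeasurableSet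
    rw [circ_zero] at this
    exact measure_eq_zero_iff_ae_notMem.1 this
  refine lt_of_le_of_lt (lintegral_mono_ae ?_) h.lintegral_lt_top
  filter_upwards [hae] with x hx
  have hs : ∀ j, 0 < ‖fourier 1 (x j) - 1‖ := by
    intro j
    rw [norm_pos_iff, sub_ne_zero]
    intro hc
    apply hx j
    apply AddCircle.injective_toCircle (T := 1) one_ne_zero
    rw [fourier_one] at hc
    ext; rw [hc]; simp
  have hW : 0 < Wt x := by
    unfold Wt
    apply Finset.sum_pos (fun j _ => pow_pos (hs j) 2) ⟨0, Finset.mem_univ _⟩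
  rw [← ENNReal.ofReal_inv_of_pos hW]
  apply ENNReal.ofReal_le_ofReal
  have hj : ∀ j, ‖fourier 1 (x j) - 1‖ ^ 2 ≤ Wt x := fun j =>
    Finset.single_le_sum (f := fun j => ‖fourier 1 (x j) - 1‖ ^ 2)
      (fun i _ => by positivity) (Finset.mem_univ j)
  have h1 : ∀ j, (Wt x) ^ (-(1/3) : ℝ) ≤ ‖fourier 1 (x j) - 1‖ ^ (-(2/3) : ℝ) := by
    intro j
    calc (Wt x) ^ (-(1/3) : ℝ) ≤ (‖fourier 1 (x j) - 1‖ ^ 2) ^ (-(1/3) : ℝ) :=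
          Real.rpow_le_rpow_of_nonpos (pow_pos (hs j) 2) (hj j) (by norm_num)
      _ = _ := by
          rw [← Real.rpow_natCast, ← Real.rpow_mul (hs j).le]; norm_num
  calc (Wt x)⁻¹ = ∏ j : Fin 3, (Wt x) ^ (-(1/3) : ℝ) := by
        rw [Finset.prod_const, ← Real.rpow_natCast, ← Real.rpow_mul hW.le]
        norm_num [Real.rpow_neg_one]
    _ ≤ _ := Finset.prod_le_prod (fun _ _ => by positivity) (fun j _ => h1 j)

open UnitAddTorus

lemma sum_int1 : Summable (fun k : ℤ => (1 + |(k:ℝ)|) ^ (-(4/3) : ℝ)) := by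
  have h1 : Summable (fun k : ℤ => |(k:ℝ)| ^ (-(4/3) : ℝ)) :=
    Real.summable_abs_int_rpow (by norm_num)
  have h2 : Summable (fun k : ℤ => if k = 0 then (1:ℝ) else 0) :=
    (hasSum_ite_eq (0:ℤ) (1:ℝ)).summable
  refine Summable.of_nonneg_of_le (fun k => by positivity) (fun k => ?_) (h1.add h2)
  by_cases hk : k = 0
  · subst hk; simp [Real.zero_rpow]
  · simp only [hk, if_false, add_zero]
    apply Real.rpow_le_rpow_of_nonpos (by positivity) (by linarith) (by norm_num)

lemma sum_Z3 : Summable (fun n : Z3 => 1 / (1 + ‖n‖) ^ 4) := by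
  have h := (sum_int1.mul_of_nonneg sum_int1 (fun k => by positivity) (fun k => by positivity)).mul_of_nonneg
    sum_int1 (fun k => by positivity) (fun k => by positivity)
  have hi : Function.Injective (fun n : Z3 => (((n 0, n 1), n 2) : (ℤ × ℤ) × ℤ)) := by
    intro a b hab
    simp only [Prod.mk.injEq] at hab
    ext i; fin_cases i <;> simp [hab]
  refine Summable.of_nonneg_of_le (fun k => by positivity) (fun n => ?_) (h.comp_injective hi)
  simp only [Function.comp]
  have hj : ∀ j, (1 + ‖n‖) ^ (-(4/3) : ℝ) ≤ (1 + |(n j : ℝ)|) ^ (-(4/3) : ℝ) := by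
    intro j
    apply Real.rpow_le_rpow_of_nonpos (by positivity) _ (by norm_num)
    have := norm_le_pi_norm n j
    rw [Int.norm_eq_abs] at this
    linarith
  calc 1 / (1 + ‖n‖) ^ 4 = (1 + ‖n‖) ^ (-(4/3) : ℝ) * (1 + ‖n‖) ^ (-(4/3) : ℝ) * (1 + ‖n‖) ^ (-(4/3) : ℝ) := by
        rw [← Real.rpow_add (by positivity), ← Real.rpow_add (by positivity), one_div,
          ← Real.rpow_natCast, ← Real.rpow_neg (by positivity)]
        norm_num
    _ ≤ _ := by
        exact mul_le_mul (mul_le_mul (hj 0) (hj 1) (by positivity) (by positivity)) (hj 2)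
          (by positivity) (by positivity)

lemma coeff_mono (n k : Z3) : mFourierCoeff (mFourier n : C(T3, ℂ)) k = if n = k then 1 else 0 := by
  rw [← mFourierCoeff_toLp, ← mFourierBasis_repr]
  have : (mFourierBasis (d := Fin 3) n) = ContinuousMap.toLp 2 volume ℂ (mFourier n) := by
    rw [coe_mFourierBasis]
  rw [← this, HilbertBasis.repr_self]
  classical
  rw [lp.single_apply]
  by_cases h : n = k
  · subst h; simp
  · rw [if_neg h, Pi.single_apply, if_neg (Ne.symm h)]

lemma cont_int {f : T3 → ℂ} (hf : Continuous f) : Integrable f :=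
  hf.integrable_of_hasCompactSupport (HasCompactSupport.of_compactSpace f)

lemma coeff_sum (s : Finset Z3) (c : Z3 → ℂ) (k : Z3) :
    mFourierCoeff (∑ n ∈ s, c n • mFourier n : C(T3, ℂ)) k = if k ∈ s then c k else 0 := by
  have : mFourierCoeff (∑ n ∈ s, c n • mFourier n : C(T3, ℂ)) k =
      ∑ n ∈ s, c n * mFourierCoeff (mFourier n : C(T3, ℂ)) k := by
    unfold mFourierCoeff
    simp only [← integral_const_mul]
    rw [← integral_finsetSum]
    · congr 1; ext t
      simp [Finset.mul_sum]
      refine Finset.sum_congr rfl fun n _ => by ring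
    · intro n _
      apply cont_int
      fun_prop
  rw [this]
  simp [coeff_mono]

lemma coeff_shift (K : C(T3, ℂ)) (j : Fin 3) (n : Z3) :
    mFourierCoeff (fun x => (fourier 1 (x j) - 1) * K x) n =
      mFourierCoeff K (n - Pi.single j 1) - mFourierCoeff K n := by
  unfold mFourierCoeff
  rw [← integral_sub (cont_int (by fun_prop)) (cont_int (by fun_prop))]
  congr 1; ext t
  have : mFourier (-(n - Pi.single j 1)) t = mFourier (-n) t * fourier 1 (t j) := by
    rw [← mFourier_single, ← mFourier_add]; congr 2; abel
  rw [this]; simp only [smul_eq_mul]; ring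

lemma parseval (f : C(T3, ℂ)) : HasSum (fun n => ‖mFourierCoeff f n‖ ^ 2) (∫ t, ‖f t‖ ^ 2) := by
  have h := hasSum_sq_mFourierCoeff (ContinuousMap.toLp 2 volume ℂ f)
  simp only [mFourierCoeff_toLp] at h
  convert h using 1
  apply integral_congr_ae
  filter_upwards [ContinuousMap.coeFn_toLp (p := 2) (𝕜 := ℂ) volume f] with t ht
  rw [ht]

def CW : ℝ≥0∞ := ∫⁻ x, (ENNReal.ofReal (Wt x))⁻¹

lemma kernel_l1 (K : C(T3, ℂ)) (d : Z3 → ℝ) (hd : Summable d)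
    (h : ∀ j n, ‖mFourierCoeff K (n - Pi.single j 1) - mFourierCoeff K n‖ ^ 2 ≤ d n) :
    ∫⁻ x, ‖K x‖ₑ ≤ (ENNReal.ofReal (3 * ∑' n, d n)) ^ (1/2 : ℝ) * CW ^ (1/2 : ℝ) := by
  have hKm : Measurable fun y => ‖K y‖ₑ := K.continuous.measurable.enorm
  have hWm : Measurable fun y => ENNReal.ofReal (Wt y) := Wt_cont.measurable.ennreal_ofReal
  have hae : ∀ᵐ x : T3, (ENNReal.ofReal (Wt x))⁻¹ < ⊤ :=
    ae_lt_top hWm.inv Wt_lint.ne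
  have e1 : ∫⁻ x, ‖K x‖ₑ = ∫⁻ x, (‖K x‖ₑ * (ENNReal.ofReal (Wt x)) ^ (1/2 : ℝ)) *
      ((ENNReal.ofReal (Wt x))⁻¹) ^ (1/2 : ℝ) := by
    apply lintegral_congr_ae
    filter_upwards [hae] with x hx
    rw [mul_assoc, ← ENNReal.mul_rpow_of_nonneg _ _ (by norm_num), ENNReal.mul_inv_cancel]
    · simp
    · simpa using hx
    · simp
  rw [e1]
  have h2 : (2:ℝ).HolderConjugate 2 := Real.HolderConjugate.two_two
  refine (ENNReal.lintegral_mul_le_Lp_mul_Lq _ h2 (hKm.mul (hWm.pow_const _)).aemeasurable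
    (hWm.inv.pow_const _).aemeasurable).trans ?_
  have e2 : ∀ z : ℝ≥0∞, (z ^ (1/2 : ℝ)) ^ (2:ℝ) = z := by
    intro z; rw [← ENNReal.rpow_mul]; norm_num
  refine mul_le_mul' (ENNReal.rpow_le_rpow ?_ (by norm_num)) (le_of_eq ?_)
  · have e3 : ∀ x, (‖K x‖ₑ * (ENNReal.ofReal (Wt x)) ^ (1/2 : ℝ)) ^ (2:ℝ) =
        ENNReal.ofReal (∑ j, ‖(fourier 1 (x j) - 1) * K x‖ ^ 2) := by
      intro x
      rw [ENNReal.mul_rpow_of_nonneg _ _ (by norm_num), e2, ← ofReal_norm,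
        ENNReal.ofReal_rpow_of_nonneg (norm_nonneg _) (by norm_num), ← ENNReal.ofReal_mul (by positivity)]
      congr 1
      simp only [Wt, Finset.mul_sum, norm_mul, mul_pow]
      refine Finset.sum_congr rfl fun j _ => ?_
      rw [mul_comm]; norm_cast
    refine (lintegral_congr e3).le.trans ?_
    have hintg : ∀ j : Fin 3, Integrable (fun x : T3 => ‖(fourier 1 (x j) - 1) * K x‖ ^ 2) := by
      intro j
      have hc : Continuous (fun x : T3 => ‖(fourier 1 (x j) - 1) * K x‖ ^ 2) := by fun_prop
      exact hc.integrable_of_hasCompactSupport (HasCompactSupport.of_compactSpace _)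
    rw [← ofReal_integral_eq_lintegral_ofReal (integrable_finsetSum _ fun j _ => hintg j)
      (ae_of_all _ fun x => by positivity), integral_finsetSum _ fun j _ => hintg j]
    apply ENNReal.ofReal_le_ofReal
    have hj : ∀ j : Fin 3, ∫ x : T3, ‖(fourier 1 (x j) - 1) * K x‖ ^ 2 ≤ ∑' n, d n := by
      intro j
      let F : C(T3, ℂ) := ⟨fun x => (fourier 1 (x j) - 1) * K x, by fun_prop⟩
      have hp := parseval F
      have hF : ∀ n, mFourierCoeff F n =
        mFourierCoeff K (n - Pi.single j 1) - mFourierCoeff K n := fun n => coeff_shift K j n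
      simp only [hF] at hp
      exact hasSum_le (fun n => h j n) hp hd.hasSum
    calc _ ≤ ∑ j : Fin 3, ∑' n, d n := Finset.sum_le_sum fun j _ => hj j
      _ = _ := by simp
  · congr 1
    exact lintegral_congr fun x => e2 _

lemma mF_sub (n : Z3) (x y : T3) : mFourier n (x - y) = mFourier n x * mFourier (-n) y := by
  simp only [mFourier, ContinuousMap.coe_mk, ← Finset.prod_mul_distrib]
  refine Finset.prod_congr rfl fun i _ => ?_
  simp [fourier_apply, sub_eq_add_neg, AddCircle.toCircle_add]

instance negInst3 : (volume : Measure UnitAddCircle).IsNegInvariant :=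
  inferInstanceAs (Measure.IsNegInvariant (AddCircle.haarAddCircle : Measure UnitAddCircle))

instance negInst3' : (volume : Measure T3).IsNegInvariant :=
  inferInstanceAs (Measure.IsNegInvariant (Measure.pi fun _ => (volume : Measure UnitAddCircle)))

lemma conv_eq (s : Finset Z3) (c : Z3 → ℂ) (g : C(T3, ℂ)) (x : T3) :
    ∫ y, (∑ n ∈ s, c n • mFourier n : C(T3, ℂ)) y * g (x - y) =
      ∑ n ∈ s, c n * mFourierCoeff g n * mFourier n x := by
  have h1 : ∀ n, ∫ y, mFourier n y * g (x - y) = mFourierCoeff g n * mFourier n x := by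
    intro n
    have := integral_sub_left_eq_self (fun y => mFourier n (x - y) * g y) (volume : Measure T3) x
    simp only [sub_sub_cancel] at this
    rw [this]
    unfold mFourierCoeff
    rw [← integral_mul_const]
    congr 1; ext y; rw [mF_sub]; simp only [smul_eq_mul]; ring
  simp only [mul_assoc, ← h1, ← integral_const_mul]
  rw [← integral_finsetSum]
  · congr 1; ext t
    simp [Finset.sum_mul, mul_assoc]
  · intro n _
    apply cont_int
    fun_prop

def phiN (N : ℕ) (n : Z3) : ℝ := max 0 (1 - ‖n‖ / (N + 1))

lemma phiN_le (N : ℕ) (n : Z3) : |phiN N n| ≤ 1 := by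
  unfold phiN
  rw [abs_of_nonneg (le_max_left _ _)]
  apply max_le zero_le_one
  have : 0 ≤ ‖n‖ / (N + 1) := by positivity
  linarith

lemma norm_single1 (j : Fin 3) : ‖(Pi.single j 1 : Z3)‖ = 1 := by
  rw [Pi.norm_single]; simp

lemma phiN_diff (N : ℕ) (n : Z3) (j : Fin 3) :
    |phiN N (n - Pi.single j 1) - phiN N n| ≤ 3 / (1 + ‖n‖) := by
  have hM : (0:ℝ) < N + 1 := by positivity
  have hM1 : (1:ℝ) ≤ N + 1 := by simp
  have hd : |‖n - Pi.single j 1‖ - ‖n‖| ≤ 1 := by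
    refine (abs_norm_sub_norm_le _ _).trans ?_
    simp [norm_single1]
  by_cases h : ‖n‖ ≤ N + 2
  · calc |phiN N (n - Pi.single j 1) - phiN N n|
        ≤ |(1 - ‖n - Pi.single j 1‖ / (N + 1)) - (1 - ‖n‖ / (N + 1))| := by
          unfold phiN
          have := abs_max_sub_max_le_abs (1 - ‖n - Pi.single j 1‖ / (N + 1)) (1 - ‖n‖ / (N + 1)) (0:ℝ)
          rwa [max_comm _ (0:ℝ), max_comm _ (0:ℝ)] at this
      _ = |‖n - Pi.single j 1‖ - ‖n‖| / (N + 1) := by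
          rw [← abs_neg, ← abs_of_pos hM, ← abs_div, abs_of_pos hM]; congr 1; ring
      _ ≤ 1 / (N + 1) := by gcongr
      _ ≤ 3 / (1 + ‖n‖) := by
          rw [div_le_div_iff₀ hM (by positivity)]; linarith
  · push Not at h
    have h1 : phiN N n = 0 := by
      apply max_eq_left
      rw [sub_nonpos, le_div_iff₀ hM]; linarith
    have h2 : phiN N (n - Pi.single j 1) = 0 := by
      apply max_eq_left
      rw [sub_nonpos, le_div_iff₀ hM]; linarith [(abs_le.1 hd).1]
    rw [h1, h2]; simp; positivity

lemma multiplier (p : ℝ≥0∞) (hp1 : 1 < p) (hp : p < ⊤) (m : Z3 → ℂ) (B : ℝ)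
    (hm : ∀ n, ‖m n‖ ≤ B / (1 + ‖n‖))
    (hd : ∀ j n, ‖m (n - Pi.single j 1) - m n‖ ≤ B / (1 + ‖n‖) ^ 2) :
    ∃ C : ℝ≥0, ∀ g : C(T3, ℂ), Summable (mFourierCoeff g) →
      eLpNorm (fun x => ∑' n, m n * mFourierCoeff g n * mFourier n x) p volume ≤
        C * eLpNorm (fun x => g x) p volume := by
  have hB : 0 ≤ B := by
    have := (norm_nonneg _).trans (hm 0); simpa using this
  set d : Z3 → ℝ := fun n => 16 * B ^ 2 * (1 / (1 + ‖n‖) ^ 4) with hdd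
  have hds : Summable d := sum_Z3.mul_left _
  set A := (ENNReal.ofReal (3 * ∑' n, d n)) ^ (1/2 : ℝ) * CW ^ (1/2 : ℝ) with hA
  have hAt : A ≠ ⊤ := by
    apply ENNReal.mul_ne_top
    · exact ENNReal.rpow_ne_top_of_nonneg (by norm_num) ENNReal.ofReal_ne_top
    · exact ENNReal.rpow_ne_top_of_nonneg (by norm_num) Wt_lint.ne
  refine ⟨A.toNNReal, fun g hg => ?_⟩
  rw [ENNReal.coe_toNNReal hAt]
  have hfin : ∀ N : ℕ, (Metric.closedBall (0 : Z3) (N + 1)).Finite := fun N =>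
    (isCompact_closedBall _ _).finite_of_discrete
  let s : ℕ → Finset Z3 := fun N => (hfin N).toFinset
  have hs : ∀ N n, n ∉ s N → phiN N n = 0 := by
    intro N n hn
    simp only [s, Set.Finite.mem_toFinset, Metric.mem_closedBall, dist_zero_right, not_le] at hn
    apply max_eq_left
    rw [sub_nonpos, le_div_iff₀ (by positivity)]; linarith
  let c : ℕ → Z3 → ℂ := fun N n => m n * (phiN N n : ℂ)
  let K : ℕ → C(T3, ℂ) := fun N => ∑ n ∈ s N, c N n • mFourier n
  have hKc : ∀ N k, mFourierCoeff (K N) k = c N k := by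
    intro N k
    simp only [K]
    rw [coeff_sum]
    split_ifs with h
    · rfl
    · simp [c, hs N k h]
  have hK : ∀ N, ∫⁻ x, ‖K N x‖ₑ ≤ A := by
    intro N
    apply kernel_l1 (K N) d hds
    intro j n
    rw [hKc, hKc]
    have : ‖c N (n - Pi.single j 1) - c N n‖ ≤ 4 * B / (1 + ‖n‖) ^ 2 := by
      calc ‖c N (n - Pi.single j 1) - c N n‖
          = ‖(m (n - Pi.single j 1) - m n) * (phiN N (n - Pi.single j 1) : ℂ) +
              m n * ((phiN N (n - Pi.single j 1) - phiN N n : ℝ) : ℂ)‖ := by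
            simp only [c]; push_cast; congr 1; ring
        _ ≤ ‖m (n - Pi.single j 1) - m n‖ * |phiN N (n - Pi.single j 1)| +
              ‖m n‖ * |phiN N (n - Pi.single j 1) - phiN N n| := by
            refine (norm_add_le _ _).trans ?_
            rw [norm_mul, norm_mul, Complex.norm_real, Complex.norm_real, Real.norm_eq_abs,
              Real.norm_eq_abs]
        _ ≤ B / (1 + ‖n‖) ^ 2 * 1 + B / (1 + ‖n‖) * (3 / (1 + ‖n‖)) := by
            gcongr
            · exact hd j n
            · exact phiN_le _ _
            · exact hm n
            · exact phiN_diff _ _ _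
        _ = _ := by field_simp; ring
    calc _ ≤ (4 * B / (1 + ‖n‖) ^ 2) ^ 2 := by gcongr
      _ = d n := by simp only [hdd]; field_simp; ring
  have hT : ∀ N x, ∫ y, K N y * g (x - y) = ∑' n, c N n * mFourierCoeff g n * mFourier n x := by
    intro N x
    rw [conv_eq, tsum_eq_sum]
    intro n hn
    simp [c, hs N n hn]
  have hnF : ∀ n (x : T3), ‖mFourier n x‖ ≤ 1 := fun n x => by
    have := (mFourier n).norm_coe_le_norm x
    rwa [mFourier_norm] at this
  have hlim : ∀ x : T3, Filter.Tendsto (fun N : ℕ => ∫ y, K N y * g (x - y)) Filter.atTop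
      (nhds (∑' n, m n * mFourierCoeff g n * mFourier n x)) := by
    intro x
    simp only [hT]
    apply tendsto_tsum_of_dominated_convergence (bound := fun n => B * ‖mFourierCoeff g n‖)
      (hg.norm.mul_left _)
    · intro n
      have hphi : Filter.Tendsto (fun N : ℕ => phiN N n) Filter.atTop (nhds 1) := by
        have h0 : Filter.Tendsto (fun N : ℕ => ‖n‖ / ((N:ℝ) + 1)) Filter.atTop (nhds 0) := by
          have := (tendsto_one_div_add_atTop_nhds_zero_nat (𝕜 := ℝ)).const_mul ‖n‖
          simpa [div_eq_mul_inv] using this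
        have h1 := (tendsto_const_nhds (x := (0:ℝ))).max ((tendsto_const_nhds (x := (1:ℝ))).sub h0)
        simpa [phiN] using h1
      have h2 : Filter.Tendsto (fun N : ℕ => c N n) Filter.atTop (nhds (m n * ((1:ℝ):ℂ))) :=
        ((Complex.continuous_ofReal.tendsto 1).comp hphi).const_mul (m n)
      have h3 := (h2.mul_const (mFourierCoeff g n)).mul_const (mFourier n x)
      simpa using h3
    · refine Filter.Eventually.of_forall fun N n => ?_
      rw [norm_mul, norm_mul]
      have hc : ‖c N n‖ ≤ B := by
        simp only [c, norm_mul, Complex.norm_real, Real.norm_eq_abs]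
        have h1 : ‖m n‖ ≤ B := (hm n).trans (div_le_self hB (by simp))
        calc _ ≤ B * 1 := by
              gcongr; exact phiN_le _ _
          _ = B := mul_one _
      calc _ ≤ B * ‖mFourierCoeff g n‖ * 1 := by
            gcongr; exact hnF _ _
        _ = _ := mul_one _
  refine (Lp.eLpNorm_lim_le_liminf_eLpNorm (f := fun N x => ∫ y, K N y * g (x - y)) ?_ _
    (ae_of_all _ hlim)).trans ?_
  · intro N
    have : Continuous (fun x : T3 => ∫ y, K N y * g (x - y)) := by
      simp only [K, conv_eq]; fun_prop
    exact this.aestronglyMeasurable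
  · refine Filter.liminf_le_of_le (by isBoundedDefault) fun b hb => ?_
    obtain ⟨N, hN⟩ := hb.exists
    exact hN.trans ((young_ineq (K N) g p hp1 hp).trans (mul_le_mul' (hK N) le_rfl))

def toT1 (t : ℝ) : UnitAddCircle := (((2 * π)⁻¹ * t : ℝ) : UnitAddCircle)
def toT (x : R3) : T3 := fun i => toT1 (x i)

lemma toT1_mp : MeasurePreserving toT1 (volume.restrict (Set.Icc 0 (2 * π)))
    (ENNReal.ofReal (2 * π) • (volume : Measure UnitAddCircle)) := by
  have hp : (0:ℝ) < 2 * π := by positivity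
  have h1 : MeasurePreserving (fun t : ℝ => (2 * π)⁻¹ * t) volume
      (ENNReal.ofReal (2 * π) • volume) := by
    refine ⟨measurable_const_mul _, ?_⟩
    rw [Real.map_volume_mul_left (by positivity), inv_inv, abs_of_pos hp]
  have h2 := h1.restrict_preimage (s := Set.Ioc 0 (0+1)) measurableSet_Ioc
  have e : (fun t : ℝ => (2 * π)⁻¹ * t) ⁻¹' Set.Ioc 0 (0+1) = Set.Ioc 0 (2 * π) := by
    ext t
    simp only [Set.mem_preimage, Set.mem_Ioc, zero_add]
    rw [inv_mul_le_iff₀ hp, mul_one, mul_pos_iff_of_pos_left (inv_pos.2 hp)]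
  rw [e, Measure.restrict_smul] at h2
  rw [← restrict_Ioc_eq_restrict_Icc]
  exact ((haar_mp 0).smul_measure _).comp h2

lemma toT_mp : MeasurePreserving toT μT3 (ENNReal.ofReal (2 * π) ^ 3 • (volume : Measure T3)) := by
  haveI : IsFiniteMeasure (ENNReal.ofReal (2 * π) • (volume : Measure UnitAddCircle)) :=
    Measure.smul_finite _ ENNReal.ofReal_ne_top
  have h := measurePreserving_pi (fun _ : Fin 3 => volume.restrict (Set.Icc 0 (2 * π)))
    (fun _ : Fin 3 => ENNReal.ofReal (2 * π) • (volume : Measure UnitAddCircle))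
    (fun _ => toT1_mp)
  have e1 : Measure.pi (fun _ : Fin 3 => volume.restrict (Set.Icc 0 (2 * π))) = μT3 := by
    rw [← Measure.restrict_pi_pi]; rfl
  have e2 : Measure.pi (fun _ : Fin 3 => ENNReal.ofReal (2 * π) • (volume : Measure UnitAddCircle))
      = ENNReal.ofReal (2 * π) ^ 3 • (volume : Measure T3) := by
    apply Measure.pi_eq
    intro s hs
    simp only [Measure.smul_apply, smul_eq_mul, Finset.prod_mul_distrib]
    rw [volume_pi_pi]
    simp
  rw [e1, e2] at h
  exact h

lemma mF_toT (n : Z3) (x : R3) : mFourier n (toT x) = eZ n x := by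
  simp only [mFourier, ContinuousMap.coe_mk, toT, toT1, eZ, dotZ]
  simp only [fourier_coe_apply]
  rw [← Complex.exp_sum]
  congr 1
  push_cast
  rw [Finset.mul_sum]
  refine Finset.sum_congr rfl fun i _ => ?_
  have : (π : ℂ) ≠ 0 := by exact_mod_cast Real.pi_ne_zero
  field_simp

lemma toT_quot : IsOpenQuotientMap toT := by
  have h1 : IsOpenQuotientMap toT1 := by
    have hq : IsOpenQuotientMap (fun t : ℝ => (t : UnitAddCircle)) :=
      QuotientAddGroup.isOpenQuotientMap_mk
    have := hq.comp (Homeomorph.mulLeft₀ ((2 * π)⁻¹ : ℝ) (by positivity)).isOpenQuotientMap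
    exact this
  exact IsOpenQuotientMap.piMap (fun _ : Fin 3 => h1)

lemma lift_exists (f : R3 → ℂ) (hf : Continuous f) (hp : Periodic3 f) :
    ∃ g : C(T3, ℂ), ∀ x, g (toT x) = f x := by
  have key : ∀ a b, toT a = toT b → (⟨f, hf⟩ : C(R3, ℂ)) a = (⟨f, hf⟩ : C(R3, ℂ)) b := by
    intro a b hab
    have h1 : ∀ i, ∃ k : ℤ, b i = a i + 2 * π * k := by
      intro i
      have h2 : toT1 (a i) = toT1 (b i) := congrFun hab i
      unfold toT1 at h2
      have h3 : (((2 * π)⁻¹ * b i - (2 * π)⁻¹ * a i : ℝ) : UnitAddCircle) = 0 := by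
        rw [AddCircle.coe_sub, h2, sub_self]
      obtain ⟨k, hk⟩ := (AddCircle.coe_eq_zero_iff (p := (1:ℝ))).1 h3
      refine ⟨k, ?_⟩
      have hp : (0:ℝ) < 2 * π := by positivity
      simp only [zsmul_eq_mul, mul_one] at hk
      rw [hk]; field_simp; ring
    choose k hk using h1
    have := hp a k
    simp only [ContinuousMap.coe_mk]
    rw [← this]; congr 1; ext i; exact (hk i).symm
  let tc : C(R3, T3) := ⟨toT, toT_quot.continuous⟩
  have hq : Topology.IsQuotientMap tc := toT_quot.isQuotientMap
  refine ⟨hq.lift ⟨f, hf⟩ key, fun x => ?_⟩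
  exact congrArg (fun F : C(R3, ℂ) => F x) (hq.lift_comp ⟨f, hf⟩ key)

lemma fCoeff_eq (f : R3 → ℂ) (g : C(T3, ℂ)) (h : ∀ x, g (toT x) = f x) (n : Z3) :
    fCoeff f n = mFourierCoeff g n := by
  have hp : (0:ℝ) < 2 * π := by positivity
  unfold fCoeff mFourierCoeff
  have e : ∀ y, Complex.exp (-(Complex.I * (dotZ n y : ℂ))) * f y =
      (fun t => mFourier (-n) t • g t) (toT y) := by
    intro y
    simp only [smul_eq_mul]
    rw [mF_toT, h]
    congr 2
    simp [dotZ]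
  simp only [e]
  have hc : Continuous (fun t => mFourier (-n) t • g t) := by fun_prop
  have hi := integral_map (μ := μT3) toT_mp.measurable.aemeasurable (f := fun t => mFourier (-n) t • g t)
    hc.aestronglyMeasurable
  rw [toT_mp.map_eq, integral_smul_measure] at hi
  change _ • (∫ y, _ ∂μT3) = _
  rw [← hi, smul_smul, ENNReal.toReal_pow, ENNReal.toReal_ofReal hp.le]
  rw [one_div_mul_cancel (by positivity), one_smul]

lemma eLp_eq (p : ℝ≥0∞) (g : T3 → ℂ) (hg : Continuous g) (hp : p ≠ ⊤) :
    eLpNorm (fun x => g (toT x)) p μT3 =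
      (ENNReal.ofReal (2 * π) ^ 3) ^ (1 / p).toReal * eLpNorm g p volume := by
  have := eLpNorm_comp_measurePreserving (p := p) (g := g) hg.aestronglyMeasurable toT_mp
  rw [eLpNorm_smul_measure_of_ne_top hp] at this
  exact this

def Ser (a : Z3 → ℂ) (x : R3) : ℂ := ∑' n, a n * eZ n x

lemma fourier_inv (f : R3 → ℂ) (hf : Continuous f) (hp : Periodic3 f)
    (hs : Summable (fCoeff f)) (x : R3) : Ser (fCoeff f) x = f x := by
  obtain ⟨g, hg⟩ := lift_exists f hf hp
  have e := fCoeff_eq f g hg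
  have hs' : Summable (mFourierCoeff g) := by convert hs using 1; ext n; exact (e n).symm
  have := (hasSum_mFourier_series_apply_of_summable hs' (toT x)).tsum_eq
  rw [hg] at this
  rw [← this]
  unfold Ser
  simp only [e, mF_toT, smul_eq_mul]

lemma mF_norm_le (n : Z3) (x : T3) : ‖mFourier n x‖ ≤ 1 := by
  have := (mFourier n).norm_coe_le_norm x
  rwa [mFourier_norm] at this

lemma serT_cont (a : Z3 → ℂ) (ha : Summable a) :
    Continuous (fun t : T3 => ∑' n, a n * mFourier n t) := by
  refine continuous_tsum (fun n => by fun_prop) ha.norm (fun n x => ?_)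
  rw [norm_mul]
  exact mul_le_of_le_one_right (norm_nonneg _) (mF_norm_le n x)

lemma ser_toT (a : Z3 → ℂ) (x : R3) : ∑' n, a n * mFourier n (toT x) = Ser a x := by
  simp only [mF_toT, Ser]

lemma fCoeff_ser (a : Z3 → ℂ) (ha : Summable a) (k : Z3) : fCoeff (Ser a) k = a k := by
  rw [fCoeff_eq (Ser a) ⟨_, serT_cont a ha⟩ (fun x => ser_toT a x)]
  unfold mFourierCoeff
  simp only [ContinuousMap.coe_mk, smul_eq_mul, ← tsum_mul_left]
  rw [← integral_tsum_of_summable_integral_norm]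
  · have e : ∀ n, ∫ t : T3, mFourier (-k) t * (a n * mFourier n t) = if n = k then a n else 0 := by
      intro n
      have := coeff_mono n k
      unfold mFourierCoeff at this
      calc _ = a n * ∫ t : T3, mFourier (-k) t • mFourier n t := by
            rw [← integral_const_mul]; congr 1; ext t; simp only [smul_eq_mul]; ring
        _ = _ := by rw [this]; simp
    simp only [e]
    rw [tsum_ite_eq]
  · intro n; exact cont_int (by fun_prop)
  · refine Summable.of_nonneg_of_le (fun n => integral_nonneg fun t => norm_nonneg _) (fun n => ?_) ha.norm
    have : ∀ t : T3, ‖mFourier (-k) t * (a n * mFourier n t)‖ ≤ ‖a n‖ := by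
      intro t
      rw [norm_mul, norm_mul]
      calc _ ≤ 1 * (‖a n‖ * 1) := by
            gcongr <;> apply mF_norm_le
        _ = _ := by ring
    calc _ ≤ ∫ t : T3, ‖a n‖ := by
          apply integral_mono_of_nonneg (ae_of_all _ fun t => norm_nonneg _) (integrable_const _)
            (ae_of_all _ this)
      _ = _ := by simp

/-- transfer of the multiplier bound to the cube -/
lemma multiplier_cube (p : ℝ≥0∞) (hp1 : 1 < p) (hp : p < ⊤) (m : Z3 → ℂ) (B : ℝ)
    (hm : ∀ n, ‖m n‖ ≤ B / (1 + ‖n‖))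
    (hd : ∀ j n, ‖m (n - Pi.single j 1) - m n‖ ≤ B / (1 + ‖n‖) ^ 2) :
    ∃ C : ℝ≥0, ∀ f : R3 → ℂ, Continuous f → Periodic3 f → Summable (fCoeff f) →
      eLpNorm (Ser fun n => m n * fCoeff f n) p μT3 ≤ C * eLpNorm f p μT3 := by
  obtain ⟨C, hC⟩ := multiplier p hp1 hp m B hm hd
  refine ⟨C, fun f hf hpf hs => ?_⟩
  obtain ⟨g, hg⟩ := lift_exists f hf hpf
  have e : fCoeff f = mFourierCoeff g := funext (fCoeff_eq f g hg)
  rw [e] at hs ⊢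
  have hB : 0 ≤ B := by
    have := (norm_nonneg _).trans (hm 0); simpa using this
  have hsm : Summable fun n => m n * mFourierCoeff g n := by
    refine Summable.of_norm_bounded (hs.norm.mul_left B) fun n => ?_
    rw [norm_mul]; gcongr; exact (hm n).trans (div_le_self hB (by simp))
  have e1 : (Ser fun n => m n * mFourierCoeff g n) = fun x =>
      (fun t : T3 => ∑' n, (m n * mFourierCoeff g n) * mFourier n t) (toT x) := by
    ext x; rw [← ser_toT]
  have e2 : f = fun x => g (toT x) := by ext x; rw [hg]
  rw [e1, e2, eLp_eq p _ (serT_cont _ hsm) hp.ne, eLp_eq p _ g.continuous hp.ne]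
  rw [mul_left_comm]
  exact mul_le_mul' le_rfl (hC g hs)

lemma cube_eq : cube = Set.Icc (fun _ : Fin 3 => (0:ℝ)) (fun _ => 2 * π) := by
  unfold cube; rw [Set.pi_univ_Icc]

lemma int_pd_zero (F : R3 → ℂ) (hF : ContDiff ℝ 1 F) (hp : Periodic3 F) (i : Fin 3) :
    ∫ x in cube, pd i F x = 0 := by
  have hpi : (0:ℝ) < 2 * π := by positivity
  have hc : Continuous (fun x => fderiv ℝ F x (Pi.single i 1)) :=
    (hF.continuous_fderiv (by norm_num)).clm_apply continuous_const
  have hsum : ∀ x, ∑ j, (if j = i then fderiv ℝ F x else 0) (Pi.single j 1) = pd i F x := by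
    intro x
    rw [Finset.sum_eq_single i]
    · simp [pd]
    · intro j _ hj; simp [hj]
    · simp
  have key := integral_divergence_of_hasFDerivAt_off_countable'
    (fun _ : Fin 3 => (0:ℝ)) (fun _ => 2 * π) (fun _ => hpi.le)
    (fun j => if j = i then F else 0) (fun j x => if j = i then fderiv ℝ F x else 0) ∅
    Set.countable_empty
    (by
      intro j
      by_cases h : j = i
      · simp only [h, if_true]; exact hF.continuous.continuousOn
      · simp only [h, if_false]; exact continuousOn_const)
    (by
      intro x _ j
      by_cases h : j = i
      · simp only [h, if_true]
        exact (hF.differentiable (by norm_num) x).hasFDerivAt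
      · simp only [h, if_false]; exact hasFDerivAt_const (0:ℂ) x)
    (by
      simp only [hsum]
      exact hc.continuousOn.integrableOn_compact isCompact_Icc)
  simp only [hsum] at key
  rw [cube_eq, key]
  apply Finset.sum_eq_zero
  intro j _
  rw [sub_eq_zero]
  congr 1
  ext x
  by_cases h : j = i
  · simp only [h, if_true]
    rw [← hp (i.insertNth 0 x) (Pi.single i 1)]
    congr 1
    ext k
    refine Fin.succAboveCases i ?_ (fun l => ?_) k
    · simp
    · simp
  · simp [h]

def Lz (n : Z3) : R3 →L[ℝ] ℝ := ∑ i, (n i : ℝ) • ContinuousLinearMap.proj (R := ℝ) (φ := fun _ : Fin 3 => ℝ) i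

lemma Lz_apply (n : Z3) (x : R3) : Lz n x = dotZ n x := by
  simp [Lz, dotZ]

lemma Lz_single (n : Z3) (i : Fin 3) : Lz n (Pi.single i 1) = n i := by
  rw [Lz_apply, dotZ]; simp [Pi.single_apply]

lemma norm_n_le (n : Z3) : ‖n‖ ≤ ∑ i, |(n i : ℝ)| := by
  refine (pi_norm_le_iff_of_nonneg (by positivity)).2 fun i => ?_
  rw [Int.norm_eq_abs]
  exact Finset.single_le_sum (f := fun i => |(n i : ℝ)|) (fun _ _ => abs_nonneg _) (Finset.mem_univ i)

lemma ni_le (n : Z3) (i : Fin 3) : |(n i : ℝ)| ≤ ‖n‖ := by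
  rw [← Int.norm_eq_abs]; exact norm_le_pi_norm n i

lemma Lz_norm (n : Z3) : ‖Lz n‖ ≤ 3 * ‖n‖ := by
  refine ContinuousLinearMap.opNorm_le_bound _ (by positivity) fun x => ?_
  rw [Lz_apply, dotZ]
  calc _ ≤ ∑ i, ‖(n i : ℝ) * x i‖ := norm_sum_le _ _
    _ ≤ ∑ i : Fin 3, ‖n‖ * ‖x‖ := by
        refine Finset.sum_le_sum fun i _ => ?_
        rw [norm_mul]
        exact mul_le_mul (ni_le n i) (norm_le_pi_norm x i) (norm_nonneg _) (norm_nonneg _)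
    _ = _ := by simp; ring

lemma eZ_deriv (n : Z3) (x : R3) :
    HasFDerivAt (eZ n) ((eZ n x * Complex.I) • (Complex.ofRealCLM.comp (Lz n))) x := by
  have h1 : HasFDerivAt (fun x => Complex.I * (dotZ n x : ℂ)) (Complex.I • (Complex.ofRealCLM.comp (Lz n))) x := by
    have : HasFDerivAt (fun x => (dotZ n x : ℂ)) (Complex.ofRealCLM.comp (Lz n)) x := by
      have := (Complex.ofRealCLM.comp (Lz n)).hasFDerivAt (x := x)
      convert this using 1
      ext x; simp [Lz_apply]
    exact this.const_mul _
  have := h1.cexp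
  rw [smul_smul] at this
  exact this

lemma eZ_norm (n : Z3) (x : R3) : ‖eZ n x‖ = 1 := by
  unfold eZ; rw [mul_comm]; exact Complex.norm_exp_ofReal_mul_I _

lemma eZ_smooth (n : Z3) : ContDiff ℝ (⊤ : ℕ∞) (eZ n) := by
  have : eZ n = fun x => Complex.exp (Complex.I * Complex.ofRealCLM.comp (Lz n) x) := by
    ext x; simp [eZ, Lz_apply]
  rw [this]
  exact (contDiff_const.mul (ContinuousLinearMap.contDiff _)).cexp

lemma eZ_per (n : Z3) : Periodic3 (eZ n) := by
  intro x k
  rw [← mF_toT, ← mF_toT]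
  congr 1
  ext i
  simp only [toT, toT1]
  have : (2 * π)⁻¹ * (x i + 2 * π * k i) = (2 * π)⁻¹ * x i + k i := by field_simp
  rw [this, AddCircle.coe_add]
  have : ((k i : ℝ) : UnitAddCircle) = 0 := (AddCircle.coe_eq_zero_iff (p := (1:ℝ))).2 ⟨k i, by simp⟩
  rw [this, add_zero]

lemma pd_per {E : Type*} [NormedAddCommGroup E] [NormedSpace ℝ E] (f : R3 → E) (hp : Periodic3 f)
    (i : Fin 3) : Periodic3 (pd i f) := by
  intro x k
  unfold pd
  have e : (fun i => x i + 2 * π * (k i)) = x + (fun i => 2 * π * (k i : ℝ)) := rfl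
  rw [e, ← fderiv_comp_add_right]
  congr 2
  ext y
  exact hp y k

lemma pd_smooth (f : R3 → ℂ) (hf : ContDiff ℝ (⊤ : ℕ∞) f) (i : Fin 3) :
    ContDiff ℝ (⊤ : ℕ∞) (pd i f) := by
  unfold pd
  exact (hf.fderiv_right (m := (⊤ : ℕ∞)) (by simp)).clm_apply contDiff_const

lemma eneg (n : Z3) (y : R3) : Complex.exp (-(Complex.I * (dotZ n y : ℂ))) = eZ (-n) y := by
  unfold eZ; congr 1; simp [dotZ]

lemma cint (f : R3 → ℂ) (hf : Continuous f) : IntegrableOn f cube := by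
  rw [cube_eq]; exact hf.continuousOn.integrableOn_compact isCompact_Icc

lemma fCoeff_pd (f : R3 → ℂ) (hf : ContDiff ℝ (⊤ : ℕ∞) f) (hp : Periodic3 f) (i : Fin 3) (n : Z3) :
    fCoeff (pd i f) n = Complex.I * n i * fCoeff f n := by
  have hs : ContDiff ℝ (⊤ : ℕ∞) (fun x => eZ (-n) x * f x) := (eZ_smooth _).mul hf
  have h0 := int_pd_zero (fun x => eZ (-n) x * f x) (hs.of_le (by exact_mod_cast le_top))
    (by intro x k; simp only; rw [eZ_per (-n) x k, hp x k]) i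
  have h1 : ∀ x, pd i (fun x => eZ (-n) x * f x) x =
      eZ (-n) x * pd i f x - (Complex.I * n i) * (eZ (-n) x * f x) := by
    intro x
    have hd := (eZ_deriv (-n) x).mul (hf.differentiable (by simp) x).hasFDerivAt
    unfold pd
    have e := hd.fderiv
    change fderiv ℝ (eZ (-n) * f) x _ = _
    rw [e]
    simp only [ContinuousLinearMap.add_apply, ContinuousLinearMap.smul_apply, ContinuousLinearMap.comp_apply,
      Lz_single, smul_eq_mul, Complex.ofRealCLM_apply]
    simp
    ring
  simp only [h1] at h0
  rw [integral_sub, integral_const_mul, sub_eq_zero] at h0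
  · unfold fCoeff
    simp only [eneg]
    rw [h0]
    simp only [Complex.real_smul]
    ring
  · exact cint _ ((eZ_smooth _).continuous.mul (pd_smooth f hf i).continuous)
  · exact (cint _ hs.continuous).const_mul _

def Rapid (a : Z3 → ℂ) : Prop := ∀ s : ℕ, ∃ C : ℝ, ∀ n, ‖a n‖ * (1 + ‖n‖) ^ s ≤ C

lemma fCoeff_bdd (f : R3 → ℂ) (n : Z3) :
    ‖fCoeff f n‖ ≤ 1 / (2 * π) ^ 3 * ∫ y in cube, ‖f y‖ := by
  unfold fCoeff
  rw [norm_smul, Real.norm_of_nonneg (by positivity)]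
  gcongr
  refine (norm_integral_le_integral_norm _).trans (le_of_eq ?_)
  congr 1; ext y
  rw [norm_mul, eneg, eZ_norm, one_mul]

lemma rapid_fCoeff (f : R3 → ℂ) (hf : ContDiff ℝ (⊤ : ℕ∞) f) (hp : Periodic3 f) :
    Rapid (fCoeff f) := by
  intro s
  induction s generalizing f with
  | zero => exact ⟨_, fun n => by simpa using fCoeff_bdd f n⟩
  | succ s ih =>
    obtain ⟨C, hC⟩ := ih f hf hp
    choose D hD using fun i => ih (pd i f) (pd_smooth f hf i) (pd_per f hp i)
    refine ⟨C + ∑ i, D i, fun n => ?_⟩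
    have h1 : ∀ i, |(n i : ℝ)| * (‖fCoeff f n‖ * (1 + ‖n‖) ^ s) ≤ D i := by
      intro i
      have := hD i n
      rw [fCoeff_pd f hf hp, norm_mul, norm_mul, Complex.norm_I, one_mul, Complex.norm_intCast] at this
      linarith
    have hnn : 0 ≤ ‖fCoeff f n‖ * (1 + ‖n‖) ^ s := by positivity
    calc ‖fCoeff f n‖ * (1 + ‖n‖) ^ (s+1)
        = ‖fCoeff f n‖ * (1 + ‖n‖) ^ s + ‖n‖ * (‖fCoeff f n‖ * (1 + ‖n‖) ^ s) := by ring
      _ ≤ ‖fCoeff f n‖ * (1 + ‖n‖) ^ s + (∑ i, |(n i : ℝ)|) * (‖fCoeff f n‖ * (1 + ‖n‖) ^ s) := by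
          gcongr; exact norm_n_le n
      _ ≤ _ := by
          rw [Finset.sum_mul]
          exact add_le_add (hC n) (Finset.sum_le_sum fun i _ => h1 i)

lemma Rapid.add {a b : Z3 → ℂ} (ha : Rapid a) (hb : Rapid b) : Rapid (fun n => a n + b n) := by
  intro s
  obtain ⟨C, hC⟩ := ha s
  obtain ⟨D, hD⟩ := hb s
  refine ⟨C + D, fun n => ?_⟩
  calc _ ≤ (‖a n‖ + ‖b n‖) * (1 + ‖n‖) ^ s := by gcongr; exact norm_add_le _ _
    _ ≤ _ := by rw [add_mul]; exact add_le_add (hC n) (hD n)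

/-- multiplication by symbols of linear growth -/
lemma Rapid.mul {a : Z3 → ℂ} (ha : Rapid a) (m : Z3 → ℂ) (B : ℝ) (hm : ∀ n, ‖m n‖ ≤ B * (1 + ‖n‖)) :
    Rapid (fun n => m n * a n) := by
  have hB : 0 ≤ B := by have := (norm_nonneg _).trans (hm 0); simpa using this
  intro s
  obtain ⟨C, hC⟩ := ha (s+1)
  refine ⟨B * C, fun n => ?_⟩
  rw [norm_mul]
  calc _ ≤ (B * (1 + ‖n‖)) * ‖a n‖ * (1 + ‖n‖) ^ s := by gcongr; exact hm n
    _ = B * (‖a n‖ * (1 + ‖n‖) ^ (s+1)) := by ring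
    _ ≤ _ := by gcongr; exact hC n

lemma Rapid.sum3 {a : Fin 3 → Z3 → ℂ} (ha : ∀ i, Rapid (a i)) : Rapid (fun n => ∑ i, a i n) := by
  simp only [Fin.sum_univ_three]
  exact ((ha 0).add (ha 1)).add (ha 2)

lemma Rapid.sumN {a : Z3 → ℂ} (ha : Rapid a) : Summable (fun n => (1 + ‖n‖) * ‖a n‖) := by
  obtain ⟨C, hC⟩ := ha 5
  refine Summable.of_nonneg_of_le (fun n => by positivity) (fun n => ?_) (sum_Z3.mul_left C)
  have : 0 < (1 + ‖n‖) := by positivity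
  rw [mul_one_div, le_div_iff₀ (by positivity)]
  calc _ = ‖a n‖ * (1 + ‖n‖) ^ 5 := by ring
    _ ≤ _ := hC n

lemma Rapid.summable {a : Z3 → ℂ} (ha : Rapid a) : Summable a := by
  refine Summable.of_norm_bounded ha.sumN fun n => ?_
  nlinarith [norm_nonneg n, norm_nonneg (a n)]

lemma Rapid.ser_deriv {a : Z3 → ℂ} (ha : Rapid a) (x : R3) :
    HasFDerivAt (Ser a) (∑' n, a n • ((eZ n x * Complex.I) • (Complex.ofRealCLM.comp (Lz n)))) x := by
  refine hasFDerivAt_tsum (𝕜 := ℝ) (u := fun n => 3 * ((1 + ‖n‖) * ‖a n‖)) (x₀ := 0)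
    (f' := fun n x => a n • ((eZ n x * Complex.I) • (Complex.ofRealCLM.comp (Lz n))))
    (ha.sumN.mul_left 3) (fun n x => (eZ_deriv n x).const_mul (a n)) ?_ ?_ x
  · intro n x
    rw [norm_smul, norm_smul, norm_mul, eZ_norm, Complex.norm_I]
    have : ‖Complex.ofRealCLM.comp (Lz n)‖ ≤ 3 * ‖n‖ := by
      refine (ContinuousLinearMap.opNorm_comp_le _ _).trans ?_
      rw [Complex.ofRealCLM_norm, one_mul]; exact Lz_norm n
    calc _ ≤ ‖a n‖ * (1 * 1 * (3 * ‖n‖)) := by gcongr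
      _ ≤ _ := by nlinarith [norm_nonneg n, norm_nonneg (a n)]
  · refine Summable.of_norm_bounded ha.summable.norm fun n => ?_
    rw [norm_mul, eZ_norm, mul_one]

lemma Rapid.ser_pd {a : Z3 → ℂ} (ha : Rapid a) (i : Fin 3) :
    pd i (Ser a) = Ser (fun n => Complex.I * n i * a n) := by
  ext x
  unfold pd
  rw [(ha.ser_deriv x).fderiv]
  have hs : Summable fun n => a n • ((eZ n x * Complex.I) • (Complex.ofRealCLM.comp (Lz n))) := by
    refine Summable.of_norm_bounded (ha.sumN.mul_left 3) fun n => ?_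
    rw [norm_smul, norm_smul, norm_mul, eZ_norm, Complex.norm_I]
    have : ‖Complex.ofRealCLM.comp (Lz n)‖ ≤ 3 * ‖n‖ := by
      refine (ContinuousLinearMap.opNorm_comp_le _ _).trans ?_
      rw [Complex.ofRealCLM_norm, one_mul]; exact Lz_norm n
    calc _ ≤ ‖a n‖ * (1 * 1 * (3 * ‖n‖)) := by gcongr
      _ ≤ _ := by nlinarith [norm_nonneg n, norm_nonneg (a n)]
  have := (ContinuousLinearMap.apply ℝ ℂ (Pi.single i 1 : R3)).map_tsum hs
  simp only [ContinuousLinearMap.apply_apply] at this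
  rw [this]
  unfold Ser
  congr 1
  ext n
  simp only [ContinuousLinearMap.smul_apply, ContinuousLinearMap.comp_apply,
      Lz_single, smul_eq_mul, Complex.ofRealCLM_apply]
  push_cast
  ring

lemma Rapid.mulN {a : Z3 → ℂ} (ha : Rapid a) (i : Fin 3) : Rapid (fun n => Complex.I * n i * a n) := by
  refine ha.mul (fun n => Complex.I * n i) 1 fun n => ?_
  rw [norm_mul, Complex.norm_I, Complex.norm_intCast]
  linarith [ni_le n i]

lemma Rapid.const {a : Z3 → ℂ} (ha : Rapid a) (c : ℂ) : Rapid (fun n => c * a n) := by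
  refine ha.mul (fun n => c) ‖c‖ fun n => ?_
  nlinarith [norm_nonneg n, norm_nonneg c]

lemma ser_summ {a : Z3 → ℂ} (ha : Rapid a) (x : R3) : Summable (fun n => a n * eZ n x) := by
  refine Summable.of_norm_bounded ha.summable.norm fun n => ?_
  rw [norm_mul, eZ_norm, mul_one]

lemma ser_add {a b : Z3 → ℂ} (ha : Rapid a) (hb : Rapid b) (x : R3) :
    Ser (fun n => a n + b n) x = Ser a x + Ser b x := by
  unfold Ser
  simp only [add_mul]
  exact (ser_summ ha x).tsum_add (ser_summ hb x)

lemma ser_const (a : Z3 → ℂ) (c : ℂ) (x : R3) :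
    Ser (fun n => c * a n) x = c * Ser a x := by
  unfold Ser
  simp only [mul_assoc]
  exact tsum_mul_left

lemma ser_sum {ι : Type*} (s : Finset ι) {a : ι → Z3 → ℂ} (ha : ∀ i, Rapid (a i)) (x : R3) :
    Ser (fun n => ∑ i ∈ s, a i n) x = ∑ i ∈ s, Ser (a i) x := by
  unfold Ser
  simp only [Finset.sum_mul]
  exact Summable.tsum_finsetSum fun i _ => ser_summ (ha i) x

lemma Rapid.ser_cont {a : Z3 → ℂ} (ha : Rapid a) : Continuous (Ser a) :=
  continuous_iff_continuousAt.2 fun x => (ha.ser_deriv x).continuousAt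

def bsym (i : Fin 3) (n : Z3) : ℝ := (n i : ℝ) / normZsq n

lemma normZsq_ge (n : Z3) : ‖n‖ ^ 2 ≤ normZsq n := by
  obtain ⟨i, hi⟩ : ∃ i, ‖n‖ = ‖n i‖ := by
    obtain ⟨i, hi⟩ := Finite.exists_max (fun i => ‖n i‖)
    exact ⟨i, le_antisymm ((pi_norm_le_iff_of_nonneg (norm_nonneg _)).2 hi) (norm_le_pi_norm n i)⟩
  rw [hi, Int.norm_eq_abs, sq_abs]
  exact Finset.single_le_sum (f := fun i => (n i : ℝ) ^ 2) (fun _ _ => sq_nonneg _) (Finset.mem_univ i)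

lemma one_le_norm (n : Z3) (hn : n ≠ 0) : 1 ≤ ‖n‖ := by
  obtain ⟨i, hi⟩ := Function.ne_iff.1 hn
  have : (1:ℝ) ≤ |(n i : ℝ)| := by exact_mod_cast Int.one_le_abs hi
  exact this.trans (ni_le n i)

lemma normZsq_pos (n : Z3) (hn : n ≠ 0) : 0 < normZsq n := by
  have := one_le_norm n hn
  have := normZsq_ge n
  nlinarith

lemma bsym_zero (i : Fin 3) : bsym i 0 = 0 := by simp [bsym]

lemma bsym_le (i : Fin 3) (n : Z3) : |bsym i n| ≤ 2 / (1 + ‖n‖) := by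
  by_cases hn : n = 0
  · subst hn; simp [bsym_zero]
  have h1 := one_le_norm n hn
  have h2 := normZsq_ge n
  have h3 := ni_le n i
  have h4 := normZsq_pos n hn
  unfold bsym
  rw [abs_div, abs_of_pos h4, div_le_div_iff₀ h4 (by positivity)]
  calc _ ≤ ‖n‖ * (1 + ‖n‖) := by gcongr
    _ ≤ 2 * ‖n‖ ^ 2 := by nlinarith
    _ ≤ _ := by linarith

lemma bn_le (j k : Fin 3) (n : Z3) : |bsym j n * n k| ≤ 1 := by
  by_cases hn : n = 0
  · subst hn; simp
  have h4 := normZsq_pos n hn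
  have h2 := normZsq_ge n
  unfold bsym
  rw [abs_mul, abs_div, abs_of_pos h4, div_mul_eq_mul_div, div_le_one h4]
  calc _ ≤ ‖n‖ * ‖n‖ := mul_le_mul (ni_le n j) (ni_le n k) (abs_nonneg _) (norm_nonneg _)
    _ ≤ _ := by nlinarith

lemma bsym_diff (i j : Fin 3) (n : Z3) :
    |bsym i (n - Pi.single j 1) - bsym i n| ≤ 6 / (1 + ‖n‖) ^ 2 := by
  set y := n - Pi.single j 1 with hy
  have hny : ‖n‖ ≤ ‖y‖ + 1 := by
    have : n = y + Pi.single j 1 := by rw [hy]; abel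
    calc ‖n‖ = ‖y + Pi.single j 1‖ := by rw [← this]
      _ ≤ _ := (norm_add_le _ _).trans (by rw [norm_single1])
  by_cases hn : n = 0
  · have : ‖y‖ = 1 := by rw [hy, hn, zero_sub, norm_neg, norm_single1]
    have h := bsym_le i y
    rw [this] at h
    rw [hn, bsym_zero, sub_zero]
    norm_num at h ⊢; linarith
  by_cases hy0 : y = 0
  · have : ‖n‖ = 1 := by
      have h0 : n - Pi.single j 1 = 0 := hy0
      rw [sub_eq_zero.1 h0, norm_single1]
    have h := bsym_le i n
    rw [this] at h
    rw [hy0, bsym_zero, zero_sub, abs_neg, this]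
    norm_num at h ⊢; linarith
  have h1 := one_le_norm n hn
  have h1' := one_le_norm y hy0
  have h2 := normZsq_ge n
  have h2' := normZsq_ge y
  have h4 := normZsq_pos n hn
  have h4' := normZsq_pos y hy0
  have hsum : ∑ i, (bsym i y - bsym i n) ^ 2 = 1 / (normZsq y * normZsq n) := by
    have e1 : ∑ i, (bsym i y - bsym i n) ^ 2 =
        (∑ i, ((y i : ℝ) - n i) ^ 2) / (normZsq y * normZsq n) := by
      have hN : normZsq n = (n 0 : ℝ) ^ 2 + (n 1 : ℝ) ^ 2 + (n 2 : ℝ) ^ 2 := by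
        simp [normZsq, Fin.sum_univ_three]
      have hY : normZsq y = (y 0 : ℝ) ^ 2 + (y 1 : ℝ) ^ 2 + (y 2 : ℝ) ^ 2 := by
        simp [normZsq, Fin.sum_univ_three]
      simp only [bsym, Fin.sum_univ_three]
      rw [hN] at h4 ⊢
      rw [hY] at h4' ⊢
      field_simp
      ring
    rw [e1]
    congr 1
    have : ∀ k, ((y k : ℝ) - n k) ^ 2 = if k = j then 1 else 0 := by
      intro k
      rw [hy]
      by_cases hk : k = j
      · subst hk; simp
      · simp [hk]
    simp [this]
  have h5 : (bsym i y - bsym i n) ^ 2 ≤ 1 / (normZsq y * normZsq n) := by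
    rw [← hsum]
    exact Finset.single_le_sum (f := fun i => (bsym i y - bsym i n) ^ 2) (fun _ _ => sq_nonneg _) (Finset.mem_univ i)
  refine abs_le_of_sq_le_sq ?_ (by positivity)
  refine h5.trans ?_
  rw [div_pow, div_le_div_iff₀ (by positivity) (by positivity)]
  have h6 : (1 + ‖n‖) ≤ 2 * ‖n‖ := by linarith
  have h7 : (1 + ‖n‖) ≤ 3 * ‖y‖ := by linarith
  calc 1 * ((1 + ‖n‖) ^ 2) ^ 2 = ((1 + ‖n‖) ^ 2) * ((1 + ‖n‖) ^ 2) := by ring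
    _ ≤ (2 * ‖n‖) ^ 2 * (3 * ‖y‖) ^ 2 := by gcongr
    _ = 36 * (‖y‖ ^ 2 * ‖n‖ ^ 2) := by ring
    _ ≤ 36 * (normZsq y * normZsq n) := by gcongr
    _ = _ := by ring

def SymB (m : Z3 → ℂ) : Prop := ∃ B : ℝ, (∀ n, ‖m n‖ ≤ B / (1 + ‖n‖)) ∧
  ∀ j n, ‖m (n - Pi.single j 1) - m n‖ ≤ B / (1 + ‖n‖) ^ 2

lemma SymB.add {m l : Z3 → ℂ} (hm : SymB m) (hl : SymB l) : SymB (fun n => m n + l n) := by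
  obtain ⟨B, h1, h2⟩ := hm
  obtain ⟨D, h3, h4⟩ := hl
  refine ⟨B + D, fun n => ?_, fun j n => ?_⟩
  · rw [add_div]; exact (norm_add_le _ _).trans (add_le_add (h1 n) (h3 n))
  · rw [add_div, add_sub_add_comm]
    exact (norm_add_le _ _).trans (add_le_add (h2 j n) (h4 j n))

lemma SymB.const {m : Z3 → ℂ} (hm : SymB m) (c : ℂ) : SymB (fun n => c * m n) := by
  obtain ⟨B, h1, h2⟩ := hm
  refine ⟨‖c‖ * B, fun n => ?_, fun j n => ?_⟩
  · rw [norm_mul, mul_div_assoc]; gcongr; exact h1 n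
  · rw [← mul_sub, norm_mul, mul_div_assoc]; gcongr; exact h2 j n

lemma symB_b (i : Fin 3) : SymB (fun n => (bsym i n : ℂ)) := by
  refine ⟨6, fun n => ?_, fun j n => ?_⟩
  · rw [Complex.norm_real, Real.norm_eq_abs]
    refine (bsym_le i n).trans ?_
    gcongr; norm_num
  · rw [← Complex.ofReal_sub, Complex.norm_real, Real.norm_eq_abs]
    exact bsym_diff i j n

lemma symB_bbn (i j k : Fin 3) : SymB (fun n => ((bsym i n * bsym j n * n k : ℝ) : ℂ)) := by
  refine ⟨22, fun n => ?_, fun l n => ?_⟩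
  · rw [Complex.norm_real, Real.norm_eq_abs, mul_assoc, abs_mul]
    calc _ ≤ 2 / (1 + ‖n‖) * 1 := by
          gcongr
          · exact bsym_le i n
          · exact bn_le j k n
      _ ≤ _ := by rw [mul_one]; gcongr; norm_num
  · rw [← Complex.ofReal_sub, Complex.norm_real, Real.norm_eq_abs]
    have hpos : 0 < 1 + ‖n‖ := by positivity
    set y := n - Pi.single l 1 with hy
    have hyn : ‖y‖ ≤ 1 + ‖n‖ := by
      rw [hy]; refine (norm_sub_le _ _).trans ?_; rw [norm_single1]; linarith
    have hk : |((y k : ℝ) - n k)| ≤ 1 := by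
      rw [hy]
      by_cases hk : k = l
      · subst hk; simp
      · simp [hk]
    have e : bsym i y * bsym j y * y k - bsym i n * bsym j n * n k =
      (bsym i y - bsym i n) * (bsym j y * y k) + bsym i n * (bsym j y - bsym j n) * y k
        + bsym i n * bsym j n * (y k - n k) := by ring
    rw [e]
    have t1 : |(bsym i y - bsym i n) * (bsym j y * y k)| ≤ 6 / (1 + ‖n‖) ^ 2 * 1 := by
      rw [abs_mul]; gcongr
      · exact bsym_diff i l n
      · exact bn_le j k y
    have t2 : |bsym i n * (bsym j y - bsym j n) * y k| ≤ 2 / (1 + ‖n‖) * (6 / (1 + ‖n‖) ^ 2) * (1 + ‖n‖) := by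
      rw [abs_mul, abs_mul]; gcongr
      · exact bsym_le i n
      · exact bsym_diff j l n
      · exact (ni_le y k).trans hyn
    have t3 : |bsym i n * bsym j n * (y k - n k)| ≤ 2 / (1 + ‖n‖) * (2 / (1 + ‖n‖)) * 1 := by
      rw [abs_mul, abs_mul]; gcongr
      · exact bsym_le i n
      · exact bsym_le j n
    refine (abs_add_le _ _).trans ((add_le_add ((abs_add_le _ _).trans (add_le_add t1 t2)) t3).trans (le_of_eq ?_))
    field_simp
    norm_num

def lam (n : Z3) : ℂ := if n = 0 then 0 else -(1 : ℂ) / (normZsq n : ℂ)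

lemma lam_le (n : Z3) : ‖lam n‖ ≤ 1 * (1 + ‖n‖) := by
  unfold lam
  by_cases hn : n = 0
  · simp [hn]
  · have h1 := one_le_norm n hn
    have h2 := normZsq_ge n
    simp only [hn, if_false]
    rw [norm_div, norm_neg, norm_one, Complex.norm_real, Real.norm_of_nonneg (normZsq_pos n hn).le]
    rw [div_le_iff₀ (normZsq_pos n hn)]
    nlinarith

lemma invLapC_eq (h : R3 → ℂ) : invLapC h = Ser (fun n => lam n * fCoeff h n) := rfl

def Uc (u : R3 → R3) (j : Fin 3) (n : Z3) : ℂ := fCoeff (fun y => (u y j : ℂ)) n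

lemma invLapV_eq (u : R3 → R3) (j : Fin 3) : invLapV u j = Ser (fun n => lam n * Uc u j n) := rfl

lemma comp_smooth (u : R3 → R3) (hu : ContDiff ℝ (⊤ : ℕ∞) (fun x => u x)) (j : Fin 3) :
    ContDiff ℝ (⊤ : ℕ∞) (fun y => (u y j : ℂ)) :=
  Complex.ofRealCLM.contDiff.comp ((contDiff_pi.1 hu) j)

lemma comp_per (u : R3 → R3) (hp : Periodic3 u) (j : Fin 3) :
    Periodic3 (fun y => (u y j : ℂ)) := by
  intro x k
  simp only [hp x k]

def Dc (u : R3 → R3) (n : Z3) : ℂ := ∑ k, Complex.I * n k * (lam n * Uc u k n)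

def rc (u : R3 → R3) (i j : Fin 3) (n : Z3) : ℂ :=
  Complex.I * n i * (lam n * Uc u j n) + Complex.I * n j * (lam n * Uc u i n)
    + (-(1 / 2) : ℂ) * (Complex.I * n i * (Complex.I * n j * (lam n * Dc u n))
      + (if i = j then 1 else 0) * Dc u n)

lemma Uc_rapid (u : R3 → R3) (hu : ContDiff ℝ (⊤ : ℕ∞) (fun x => u x)) (hp : Periodic3 u)
    (j : Fin 3) : Rapid (Uc u j) :=
  rapid_fCoeff _ (comp_smooth u hu j) (comp_per u hp j)

lemma lamU_rapid (u : R3 → R3) (hu : ContDiff ℝ (⊤ : ℕ∞) (fun x => u x)) (hp : Periodic3 u)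
    (j : Fin 3) : Rapid (fun n => lam n * Uc u j n) :=
  (Uc_rapid u hu hp j).mul lam 1 lam_le

lemma Dc_rapid (u : R3 → R3) (hu : ContDiff ℝ (⊤ : ℕ∞) (fun x => u x)) (hp : Periodic3 u) :
    Rapid (Dc u) :=
  Rapid.sum3 fun k => (lamU_rapid u hu hp k).mulN k

lemma lamD_rapid (u : R3 → R3) (hu : ContDiff ℝ (⊤ : ℕ∞) (fun x => u x)) (hp : Periodic3 u) :
    Rapid (fun n => lam n * Dc u n) :=
  (Dc_rapid u hu hp).mul lam 1 lam_le

lemma divInvLap_eq (u : R3 → R3) (hu : ContDiff ℝ (⊤ : ℕ∞) (fun x => u x)) (hp : Periodic3 u) :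
    divInvLap u = Ser (Dc u) := by
  ext x
  unfold divInvLap
  simp only [invLapV_eq, (lamU_rapid u hu hp _).ser_pd]
  exact (ser_sum Finset.univ (a := fun k n => Complex.I * n k * (lam n * Uc u k n))
    (fun k => (lamU_rapid u hu hp k).mulN k) x).symm

lemma rc_rapid (u : R3 → R3) (hu : ContDiff ℝ (⊤ : ℕ∞) (fun x => u x)) (hp : Periodic3 u)
    (i j : Fin 3) : Rapid (rc u i j) :=
  (((lamU_rapid u hu hp j).mulN i).add ((lamU_rapid u hu hp i).mulN j)).add
    (((((lamD_rapid u hu hp).mulN j).mulN i).add ((Dc_rapid u hu hp).const _)).const _)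

lemma Rinv_eq (u : R3 → R3) (hu : ContDiff ℝ (⊤ : ℕ∞) (fun x => u x)) (hp : Periodic3 u)
    (x : R3) (i j : Fin 3) : Rinv u x i j = Ser (rc u i j) x := by
  have h1 := (lamU_rapid u hu hp j).mulN i
  have h2 := (lamU_rapid u hu hp i).mulN j
  have h3 := ((lamD_rapid u hu hp).mulN j).mulN i
  have h4 := (Dc_rapid u hu hp).const (if i = j then 1 else 0)
  unfold Rinv
  have e : fCoeff (Ser (Dc u)) = Dc u := funext (fCoeff_ser _ (Dc_rapid u hu hp).summable)
  rw [invLapC_eq, divInvLap_eq u hu hp, e, invLapV_eq, invLapV_eq,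
    (lamU_rapid u hu hp j).ser_pd, (lamU_rapid u hu hp i).ser_pd,
    (lamD_rapid u hu hp).ser_pd, ((lamD_rapid u hu hp).mulN j).ser_pd]
  have := ser_add (h1.add h2) ((h3.add h4).const (-(1 / 2) : ℂ)) x
  rw [ser_add h1 h2, ser_const, ser_add h3 h4, ser_const] at this
  change _ = Ser _ x
  refine Eq.trans ?_ this.symm
  split_ifs <;> ring

lemma lam_id (n : Z3) (hn : n ≠ 0) :
    Complex.I ^ 2 * (lam n * ((n 0 : ℂ) ^ 2 + (n 1 : ℂ) ^ 2 + (n 2 : ℂ) ^ 2)) = 1 := by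
  have h := normZsq_pos n hn
  have e : ((n 0 : ℂ) ^ 2 + (n 1 : ℂ) ^ 2 + (n 2 : ℂ) ^ 2) = (normZsq n : ℂ) := by
    simp [normZsq, Fin.sum_univ_three]
  have h' : (normZsq n : ℂ) ≠ 0 := by exact_mod_cast h.ne'
  rw [e, lam, if_neg hn, Complex.I_sq]
  field_simp

lemma rc_symm (u : R3 → R3) (i j : Fin 3) : rc u i j = rc u j i := by
  ext n
  unfold rc
  rw [if_congr (eq_comm (a := i) (b := j)) rfl rfl]
  ring

lemma rc_zero (u : R3 → R3) (i j : Fin 3) : rc u i j 0 = 0 := by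
  simp [rc, Dc]

lemma rc_trace (u : R3 → R3) (n : Z3) : ∑ i, rc u i i n = 0 := by
  by_cases hn : n = 0
  · subst hn; simp [rc_zero]
  have h := lam_id n hn
  simp only [rc, Fin.sum_univ_three, if_true]
  have hD : Dc u n = Complex.I * n 0 * (lam n * Uc u 0 n) + Complex.I * n 1 * (lam n * Uc u 1 n)
    + Complex.I * n 2 * (lam n * Uc u 2 n) := by simp only [Dc, Fin.sum_univ_three]
  linear_combination (-(1 / 2) * Dc u n) * h - 2 * hD

lemma rc_div (u : R3 → R3) (i : Fin 3) (n : Z3) (hn : n ≠ 0) :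
    ∑ j, Complex.I * n j * rc u i j n = Uc u i n := by
  have h := lam_id n hn
  have hD : Dc u n = Complex.I * n 0 * (lam n * Uc u 0 n) + Complex.I * n 1 * (lam n * Uc u 1 n)
    + Complex.I * n 2 * (lam n * Uc u 2 n) := by simp only [Dc, Fin.sum_univ_three]
  have hs : ∑ j, Complex.I * n j * ((if i = j then 1 else 0) * Dc u n) = Complex.I * n i * Dc u n := by
    simp
  have e : ∀ j, Complex.I * n j * rc u i j n = Complex.I * n j * (Complex.I * n i * (lam n * Uc u j n)
      + Complex.I * n j * (lam n * Uc u i n)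
      + (-(1 / 2) : ℂ) * (Complex.I * n i * (Complex.I * n j * (lam n * Dc u n))))
      + (-(1 / 2) : ℂ) * (Complex.I * n j * ((if i = j then 1 else 0) * Dc u n)) := by
    intro j; unfold rc; ring
  simp only [e]
  rw [Finset.sum_add_distrib, ← Finset.mul_sum, hs, Fin.sum_univ_three]
  linear_combination (Uc u i n - 1 / 2 * Complex.I * n i * Dc u n) * h - Complex.I * n i * hD

lemma Uc_zero (u : R3 → R3) (hu : ContDiff ℝ (⊤ : ℕ∞) (fun x => u x))
    (h0 : (∫ x in cube, u x) = 0) (i : Fin 3) : Uc u i 0 = 0 := by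
  have hi : IntegrableOn u cube := by
    rw [cube_eq]; exact hu.continuous.continuousOn.integrableOn_compact isCompact_Icc
  have := (ContinuousLinearMap.proj (R := ℝ) (φ := fun _ : Fin 3 => ℝ) i).integral_comp_comm hi
  rw [h0] at this
  simp only [ContinuousLinearMap.proj_apply, Pi.zero_apply] at this
  have h2 : ∫ y in cube, (u y i : ℂ) = 0 := by
    rw [integral_complex_ofReal, this]; simp
  unfold Uc fCoeff
  simp [dotZ, h2]

def Mc (i j k : Fin 3) (n : Z3) : ℂ :=
  ((if j = k then -Complex.I else 0) * (bsym i n : ℂ) + (if i = k then -Complex.I else 0) * (bsym j n : ℂ))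
    + (((Complex.I / 2) * ((bsym i n * bsym j n * n k : ℝ) : ℂ))
      + (if i = j then Complex.I / 2 else 0) * (bsym k n : ℂ))

lemma Mc_sym (i j k : Fin 3) : SymB (Mc i j k) :=
  (((symB_b i).const _).add ((symB_b j).const _)).add
    (((symB_bbn i j k).const _).add ((symB_b k).const _))

lemma lam_b (n : Z3) (i : Fin 3) : (n i : ℂ) * lam n = -(bsym i n : ℂ) := by
  by_cases hn : n = 0
  · subst hn; simp [bsym_zero]
  · simp only [lam, hn, if_false, bsym]
    push_cast
    ring

lemma b_swap (n : Z3) (j k : Fin 3) : (n j : ℂ) * (bsym k n : ℂ) = (bsym j n : ℂ) * n k := by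
  rw [bsym, bsym]; push_cast; ring

lemma rc_M (u : R3 → R3) (i j : Fin 3) (n : Z3) : rc u i j n = ∑ k, Mc i j k n * Uc u k n := by
  have h1 : ∑ k, (if j = k then -Complex.I else 0) * (bsym i n : ℂ) * Uc u k n
      = Complex.I * n i * (lam n * Uc u j n) := by
    simp only [ite_mul, zero_mul, Finset.sum_ite_eq, Finset.mem_univ, if_true]
    linear_combination (-Complex.I * Uc u j n) * lam_b n i
  have h2 : ∑ k, (if i = k then -Complex.I else 0) * (bsym j n : ℂ) * Uc u k n
      = Complex.I * n j * (lam n * Uc u i n) := by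
    simp only [ite_mul, zero_mul, Finset.sum_ite_eq, Finset.mem_univ, if_true]
    linear_combination (-Complex.I * Uc u i n) * lam_b n j
  have hD : Dc u n = ∑ k, -Complex.I * (bsym k n : ℂ) * Uc u k n := by
    unfold Dc
    refine Finset.sum_congr rfl fun k _ => ?_
    linear_combination (Complex.I * Uc u k n) * lam_b n k
  have h3 : ∑ k, (Complex.I / 2) * ((bsym i n * bsym j n * n k : ℝ) : ℂ) * Uc u k n
      = (-(1 / 2) : ℂ) * (Complex.I * n i * (Complex.I * n j * (lam n * Dc u n))) := by
    rw [hD]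
    simp only [Finset.mul_sum]
    refine Finset.sum_congr rfl fun k _ => ?_
    push_cast
    linear_combination (-(Complex.I / 2) * bsym i n * Uc u k n) * b_swap n j k
      + (-(1 / 2) * Complex.I ^ 3 * Uc u k n * n j * bsym k n) * lam_b n i
      + (1 / 2 * Complex.I * bsym i n * Uc u k n * n j * bsym k n) * Complex.I_sq
  have h4 : ∑ k, (if i = j then Complex.I / 2 else 0) * (bsym k n : ℂ) * Uc u k n
      = (-(1 / 2) : ℂ) * ((if i = j then 1 else 0) * Dc u n) := by
    rw [hD]
    simp only [Finset.mul_sum]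
    refine Finset.sum_congr rfl fun k _ => ?_
    split_ifs <;> ring
  simp only [Mc, add_mul, Finset.sum_add_distrib]
  rw [h1, h2, h3, h4]
  unfold rc
  ring

lemma Lp_part (p : ℝ≥0∞) (hp1 : 1 < p) (hpt : p < ⊤) :
      ∃ C : ℝ≥0, 0 < C ∧
        ∀ u : R3 → R3, ContDiff ℝ (⊤ : ℕ∞) (fun x => u x) → Periodic3 u →
          eLpNorm (fun x => Rinv u x) p μT3 ≤ C * eLpNorm (fun x => u x) p μT3 := by
  have key : ∀ t : Fin 3 × Fin 3 × Fin 3, ∃ C : ℝ≥0, ∀ f : R3 → ℂ, Continuous f → Periodic3 f →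
      Summable (fCoeff f) →
      eLpNorm (Ser fun n => Mc t.1 t.2.1 t.2.2 n * fCoeff f n) p μT3 ≤ C * eLpNorm f p μT3 := by
    intro t
    obtain ⟨B, h1, h2⟩ := Mc_sym t.1 t.2.1 t.2.2
    exact multiplier_cube p hp1 hpt _ B h1 h2
  choose C hC using key
  refine ⟨∑ t, C t + 1, by positivity, fun u hu hp => ?_⟩
  have hrap : ∀ i j k, Rapid (fun n => Mc i j k n * Uc u k n) := by
    intro i j k
    obtain ⟨B, h1, -⟩ := Mc_sym i j k
    have hB : 0 ≤ B := by have := (norm_nonneg _).trans (h1 0); simpa using this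
    refine (Uc_rapid u hu hp k).mul _ B fun n => (h1 n).trans ?_
    have : 1 ≤ 1 + ‖n‖ := by simp
    exact (div_le_self hB this).trans (le_mul_of_one_le_right hB this)
  let G : Fin 3 × Fin 3 × Fin 3 → R3 → ℝ :=
    fun t x => ‖Ser (fun n => Mc t.1 t.2.1 t.2.2 n * Uc u t.2.2 n) x‖
  have hG0 : ∀ t x, 0 ≤ G t x := fun t x => norm_nonneg _
  have hpt2 : ∀ x, ‖Rinv u x‖ ≤ ‖(∑ t, G t) x‖ := by
    intro x
    rw [Finset.sum_apply, Real.norm_of_nonneg (Finset.sum_nonneg fun t _ => hG0 t x)]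
    refine (pi_norm_le_iff_of_nonneg (Finset.sum_nonneg fun t _ => hG0 t x)).2 fun i => ?_
    refine (pi_norm_le_iff_of_nonneg (Finset.sum_nonneg fun t _ => hG0 t x)).2 fun j => ?_
    rw [Rinv_eq u hu hp, funext (rc_M u i j), ser_sum Finset.univ (hrap i j)]
    refine (norm_sum_le _ _).trans ?_
    have : ∑ k, G (i, j, k) x ≤ ∑ t, G t x := by
      rw [← Finset.sum_image (f := fun t => G t x) (g := fun k => (i, j, k))]
      · exact Finset.sum_le_sum_of_subset_of_nonneg (Finset.subset_univ _) fun t _ _ => hG0 t x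
      · intro a _ b _ hab; simpa using hab
    exact this
  have hone : 1 ≤ p := hp1.le
  calc eLpNorm (fun x => Rinv u x) p μT3 ≤ eLpNorm (∑ t, G t) p μT3 := eLpNorm_mono hpt2
    _ ≤ ∑ t, eLpNorm (G t) p μT3 :=
        eLpNorm_sum_le (fun t _ => (hrap t.1 t.2.1 t.2.2).ser_cont.norm.aestronglyMeasurable) hone
    _ ≤ ∑ t, C t * eLpNorm (fun x => u x) p μT3 := by
        refine Finset.sum_le_sum fun t _ => ?_
        have h1 := hC t (fun y => (u y t.2.2 : ℂ)) (comp_smooth u hu _).continuous (comp_per u hp _)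
          (Uc_rapid u hu hp _).summable
        have h2 : eLpNorm (G t) p μT3 =
          eLpNorm (Ser fun n => Mc t.1 t.2.1 t.2.2 n * fCoeff (fun y => (u y t.2.2 : ℂ)) n) p μT3 :=
          eLpNorm_norm _
        rw [h2]
        refine h1.trans (mul_le_mul' le_rfl (eLpNorm_mono fun x => ?_))
        rw [Complex.norm_real]
        exact norm_le_pi_norm (u x) _
    _ = ((∑ t, C t : ℝ≥0) : ℝ≥0∞) * eLpNorm (fun x => u x) p μT3 := by
        rw [← Finset.sum_mul]; push_cast; rfl
    _ ≤ _ := by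
        gcongr
        simp

end

/-- `R` takes values in the symmetric traceless matrices, is a right inverse of the
divergence (`div (Ru) = u`), and is bounded on `L^p(T³)` for every `1 < p < ∞`. -/
theorem inverse_divergence_operator :
    (∀ u : R3 → R3, ContDiff ℝ (⊤ : ℕ∞) (fun x => u x) → Periodic3 u →
        (∫ x in cube, u x) = 0 →
        (∀ (x : R3) (i j : Fin 3), Rinv u x i j = Rinv u x j i) ∧
        (∀ x : R3, (∑ i, Rinv u x i i) = 0) ∧
        (∀ (x : R3) (i : Fin 3), (∑ j, pd j (fun y => Rinv u y i j) x) = (u x i : ℂ))) ∧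
    (∀ p : ℝ≥0∞, 1 < p → p < ⊤ →
      ∃ C : ℝ≥0, 0 < C ∧
        ∀ u : R3 → R3, ContDiff ℝ (⊤ : ℕ∞) (fun x => u x) → Periodic3 u →
          (∫ x in cube, u x) = 0 →
          eLpNorm (fun x => Rinv u x) p μT3 ≤ C * eLpNorm (fun x => u x) p μT3) := by
  refine ⟨fun u hu hp h0 => ⟨fun x i j => ?_, fun x => ?_, fun x i => ?_⟩, fun p hp1 hpt => ?_⟩
  · rw [Rinv_eq u hu hp, Rinv_eq u hu hp, rc_symm]
  · simp only [Rinv_eq u hu hp]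
    rw [← ser_sum Finset.univ (a := fun i => rc u i i) (fun i => rc_rapid u hu hp i i)]
    simp [rc_trace, Ser]
  · have e : ∀ j, (fun y => Rinv u y i j) = Ser (rc u i j) := fun j =>
      funext fun y => Rinv_eq u hu hp y i j
    simp only [e, (rc_rapid u hu hp i _).ser_pd]
    rw [← ser_sum Finset.univ (a := fun j n => Complex.I * n j * rc u i j n)
      (fun j => (rc_rapid u hu hp i j).mulN j)]
    have e2 : (fun n : Z3 => ∑ j, Complex.I * n j * rc u i j n) = fCoeff (fun y => (u y i : ℂ)) := by
      ext n
      by_cases hn : n = 0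
      · subst hn
        have := Uc_zero u hu h0 i
        rw [Uc] at this
        rw [this]
        simp
      · exact rc_div u i n hn
    rw [e2]
    exact fourier_inv _ (comp_smooth u hu i).continuous (comp_per u hp i) (Uc_rapid u hu hp i).summable x
  · obtain ⟨C, hC, h⟩ := Lp_part p hp1 hpt
    exact ⟨C, hC, fun u hu hp _ => h u hu hp⟩
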